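/- arXiv:2104.08327 — 6 statements merged into one kernel-verified Lean document; each statement's English description precedes it below -/
import Mathlib

section
/- Existence of the k-th polynomials of the Hermite–Padé m-system: for every integer m ≥ 1, every k with 1 ≤ k ≤ m, every n ≥ 1, and every tuple of formal power series F_0 = 1, F_1, …, F_m ∈ ℂ⟦t⟧, there exists a family of polynomials (P_I)_I, indexed by the k-element subsets I of {0,1,…,m}, with deg P_I ≤ (m+1−k)·n for every I and with P_I ≠ 0 for at least one I, such that for every k-element subset J = {j_1 < ⋯ < j_k} of {1,…,m} the Laurent series ι(P_J) + Σ_{s=1}^{k} (−1)^s · ι(P_{(J∖{j_s})∪{0}}) · F_{j_s} is O(z^{−(kn+1)}) at ∞. -/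
/-- The Laurent series at infinity associated with a polynomial `P ∈ ℂ[z]`:
`ι(P) = ∑ⱼ (coefficient of zʲ in P) · t^(−j)`, where `t = 1/z`. -/
noncomputable def polyToLaurent (P : Polynomial ℂ) : LaurentSeries ℂ :=
  ∑ j ∈ Finset.range (P.natDegree + 1), HahnSeries.single (-(j : ℤ)) (P.coeff j)

/-- A formal power series in `t = 1/z` (a germ holomorphic at `∞`), viewed as a
formal Laurent series. -/
noncomputable def psToLaurent (F : PowerSeries ℂ) : LaurentSeries ℂ :=
  HahnSeries.ofPowerSeries ℤ ℂ F

/-- A Laurent series `G` in `t = 1/z` is `O(z^(−r))` at `∞` iff the coefficient of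
`t^l` vanishes for all `l < r`. -/
def IsBigOAtInfty (G : LaurentSeries ℂ) (r : ℤ) : Prop :=
  ∀ l : ℤ, l < r → G.coeff l = 0

theorem polyToLaurent_coeff (P : Polynomial ℂ) (l : ℤ) :
    (polyToLaurent P).coeff l = if l ≤ 0 then P.coeff (-l).toNat else 0 := by
  unfold polyToLaurent
  rw [HahnSeries.coeff_sum]
  simp only [HahnSeries.coeff_single]
  split_ifs with h
  · by_cases h2 : (-l).toNat ∈ Finset.range (P.natDegree + 1)
    · rw [Finset.sum_eq_single_of_mem _ h2]
      · rw [if_pos (by omega)]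
      · intro b _ hb
        rw [if_neg (by omega)]
    · rw [Polynomial.coeff_eq_zero_of_natDegree_lt (by simpa using h2)]
      apply Finset.sum_eq_zero
      intro b hb
      rw [if_neg]
      rintro rfl
      apply h2
      simpa using hb
  · apply Finset.sum_eq_zero
    intro b _
    rw [if_neg (by omega)]

theorem polyToLaurent_add (P Q : Polynomial ℂ) :
    polyToLaurent (P + Q) = polyToLaurent P + polyToLaurent Q := by
  ext l
  simp only [polyToLaurent_coeff, HahnSeries.coeff_add, Polynomial.coeff_add]
  split_ifs <;> simp

theorem polyToLaurent_smul (c : ℂ) (P : Polynomial ℂ) :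
    polyToLaurent (c • P) = c • polyToLaurent P := by
  ext l
  simp only [polyToLaurent_coeff, HahnSeries.coeff_smul, Polynomial.coeff_smul]
  split_ifs <;> simp

theorem psToLaurent_coeff_neg (F : PowerSeries ℂ) (l : ℤ) (hl : l < 0) :
    (psToLaurent F).coeff l = 0 := by
  unfold psToLaurent
  rw [HahnSeries.ofPowerSeries_apply]
  apply HahnSeries.embDomain_of_notMem_range
  rintro ⟨a, ha⟩
  simp at ha
  omega

theorem polyToLaurent_coeff_low (P : Polynomial ℂ) (D : ℕ) (hP : P.natDegree ≤ D) (l : ℤ)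
    (hl : l < -(D : ℤ)) : (polyToLaurent P).coeff l = 0 := by
  rw [polyToLaurent_coeff]
  split_ifs
  · exact Polynomial.coeff_eq_zero_of_natDegree_lt (by omega)
  · rfl

theorem prod_coeff_low (P : Polynomial ℂ) (F : PowerSeries ℂ) (D : ℕ) (hP : P.natDegree ≤ D)
    (l : ℤ) (hl : l < -(D : ℤ)) : (polyToLaurent P * psToLaurent F).coeff l = 0 := by
  rw [HahnSeries.coeff_mul]
  apply Finset.sum_eq_zero
  rintro ⟨i, j⟩ hij
  have h := (Finset.mem_addAntidiagonal.1 hij).2.2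
  simp only at h ⊢
  by_cases hi : i < -(D : ℤ)
  · rw [polyToLaurent_coeff_low P D hP i hi, zero_mul]
  · rw [psToLaurent_coeff_neg F j (by omega), mul_zero]

/-- The linear form attached to `J`. -/
noncomputable def hpForm {m : ℕ} (F : Fin (m + 1) → PowerSeries ℂ) (J : Finset (Fin (m + 1))) :
    (Finset (Fin (m + 1)) → Polynomial ℂ) →ₗ[ℂ] LaurentSeries ℂ where
  toFun P := polyToLaurent (P J) +
            ∑ j ∈ J, (-1 : LaurentSeries ℂ) ^ (J.filter (· ≤ j)).card *
              polyToLaurent (P (insert 0 (J.erase j))) * psToLaurent (F j)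
  map_add' P Q := by
    simp only [Pi.add_apply, polyToLaurent_add, mul_add, add_mul, Finset.sum_add_distrib]
    abel
  map_smul' c P := by
    simp only [Pi.smul_apply, polyToLaurent_smul, RingHom.id_apply]
    simp only [← HahnSeries.C_mul_eq_smul]
    rw [mul_add, Finset.mul_sum]
    congr 1
    apply Finset.sum_congr rfl
    intro j _
    ring

theorem hpForm_low {m : ℕ} (F : Fin (m + 1) → PowerSeries ℂ) (J : Finset (Fin (m + 1)))
    (P : Finset (Fin (m + 1)) → Polynomial ℂ) (D : ℕ) (hP : ∀ I, (P I).natDegree ≤ D)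
    (l : ℤ) (hl : l < -(D : ℤ)) : (hpForm F J P).coeff l = 0 := by
  change (polyToLaurent (P J) + ∑ j ∈ J, _).coeff l = 0
  rw [HahnSeries.coeff_add, polyToLaurent_coeff_low _ D (hP _) l hl, zero_add,
    HahnSeries.coeff_sum]
  apply Finset.sum_eq_zero
  intro j _
  have := prod_coeff_low (P (insert 0 (J.erase j))) (F j) D (hP _) l hl
  rcases neg_one_pow_eq_or (LaurentSeries ℂ) (J.filter (· ≤ j)).card with h | h
  · rw [h, one_mul, this]
  · rw [h, mul_assoc, neg_one_mul, HahnSeries.coeff_neg, this, neg_zero]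

/-- Extension by zero of a family of polynomials of bounded degree. -/
noncomputable def hpExt (m k D : ℕ) :
    ({I : Finset (Fin (m + 1)) // I.card = k} → Polynomial.degreeLT ℂ (D + 1)) →ₗ[ℂ]
      (Finset (Fin (m + 1)) → Polynomial ℂ) where
  toFun v I := if h : I.card = k then (v ⟨I, h⟩ : Polynomial ℂ) else 0
  map_add' v w := by
    ext1 I
    by_cases h : I.card = k <;> simp [h]
  map_smul' c v := by
    ext1 I
    by_cases h : I.card = k <;> simp [h]

theorem hpExt_natDegree (m k D : ℕ)
    (v : {I : Finset (Fin (m + 1)) // I.card = k} → Polynomial.degreeLT ℂ (D + 1))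
    (I : Finset (Fin (m + 1))) : (hpExt m k D v I).natDegree ≤ D := by
  change (if h : I.card = k then (v ⟨I, h⟩ : Polynomial ℂ) else 0).natDegree ≤ D
  split_ifs with h
  · have := Polynomial.mem_degreeLT.1 (v ⟨I, h⟩).2
    rw [Polynomial.natDegree_le_iff_coeff_eq_zero]
    intro N hN
    exact Polynomial.coeff_eq_zero_of_degree_lt (lt_of_lt_of_le this (by exact_mod_cast hN))
  · simp

/-- The coefficient conditions. -/
noncomputable def hpMap (m k D N : ℕ) (F : Fin (m + 1) → PowerSeries ℂ) :
    ({I : Finset (Fin (m + 1)) // I.card = k} → Polynomial.degreeLT ℂ (D + 1)) →ₗ[ℂ]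
      ((Finset.powersetCard k (Finset.univ.erase (0 : Fin (m + 1)))) → Fin N → ℂ) where
  toFun v J i := (hpForm F J.1 (hpExt m k D v)).coeff ((i : ℤ) - D)
  map_add' v w := by
    ext J i
    simp
  map_smul' c v := by
    ext J i
    simp

theorem hp_count (m k n : ℕ) (hk1 : 1 ≤ k) (hkm : k ≤ m) :
    m.choose k * ((m + 1) * n + 1) < (m + 1).choose k * ((m + 1 - k) * n + 1) := by
  have h1 := Nat.choose_mul_succ_eq m k
  have h2 : m.choose k < (m + 1).choose k := by
    obtain ⟨j, rfl⟩ := Nat.exists_eq_add_of_le' hk1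
    rw [Nat.choose_succ_succ']
    have := Nat.choose_pos (show j ≤ m by omega)
    omega
  calc m.choose k * ((m + 1) * n + 1) = m.choose k * (m + 1) * n + m.choose k := by ring
    _ < (m + 1).choose k * (m + 1 - k) * n + (m + 1).choose k := by rw [h1]; omega
    _ = _ := by ring

/-- Existence of the `k`-th polynomials of the Hermite–Padé `m`-system of order `n`:
there is a family of polynomials `P_I`, indexed by the `k`-element subsets `I` of
`{0, 1, …, m}`, of degrees at most `(m + 1 − k)·n`, not all zero, such that for every
`k`-element subset `J = {j₁ < ⋯ < j_k}` of `{1, …, m}` the Laurent series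
`ι(P_J) + ∑ₛ (−1)ˢ · ι(P_{(J∖{jₛ})∪{0}}) · F_{jₛ}` is `O(z^(−(kn+1)))` at `∞`. -/
theorem hermitePade_m_system_exists
    (m k n : ℕ) (hm : 1 ≤ m) (hk1 : 1 ≤ k) (hkm : k ≤ m) (hn : 1 ≤ n)
    (F : Fin (m + 1) → PowerSeries ℂ) (hF0 : F 0 = 1) :
    ∃ P : Finset (Fin (m + 1)) → Polynomial ℂ,
      (∀ I : Finset (Fin (m + 1)), I.card = k →
        (P I).natDegree ≤ (m + 1 - k) * n) ∧
      (∃ I : Finset (Fin (m + 1)), I.card = k ∧ P I ≠ 0) ∧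
      (∀ J : Finset (Fin (m + 1)), J.card = k → (0 : Fin (m + 1)) ∉ J →
        IsBigOAtInfty
          (polyToLaurent (P J) +
            ∑ j ∈ J, (-1 : LaurentSeries ℂ) ^ (J.filter (· ≤ j)).card *
              polyToLaurent (P (insert 0 (J.erase j))) * psToLaurent (F j))
          (k * n + 1)) := by
  set D := (m + 1 - k) * n with hD
  have hfin : Module.Finite ℂ (Polynomial.degreeLT ℂ (D + 1)) :=
    Module.Finite.equiv (Polynomial.degreeLTEquiv ℂ (D + 1)).symm
  have hlt : Module.finrank ℂ
      ((Finset.powersetCard k (Finset.univ.erase (0 : Fin (m + 1)))) →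
        Fin ((m + 1) * n + 1) → ℂ) <
      Module.finrank ℂ
        ({I : Finset (Fin (m + 1)) // I.card = k} → Polynomial.degreeLT ℂ (D + 1)) := by
    have e : Module.finrank ℂ (Polynomial.degreeLT ℂ (D + 1)) = D + 1 := by
      rw [(Polynomial.degreeLTEquiv ℂ (D + 1)).finrank_eq]; simp
    have := hp_count m k n hk1 hkm
    have e2 : Module.finrank ℂ
        ({I : Finset (Fin (m + 1)) // I.card = k} → Polynomial.degreeLT ℂ (D + 1)) =
        (m + 1).choose k * (D + 1) := by
      rw [Module.finrank_pi_fintype]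
      simp [e, Fintype.card_finset_len]
    rw [e2, Module.finrank_pi_fintype]
    simpa using this
  obtain ⟨v, hv, hv0⟩ := Submodule.exists_mem_ne_zero_of_ne_bot
    (LinearMap.ker_ne_bot_of_finrank_lt (f := hpMap m k D ((m + 1) * n + 1) F) hlt)
  refine ⟨hpExt m k D v, fun I _ => hpExt_natDegree m k D v I, ?_, ?_⟩
  · obtain ⟨I, hI⟩ := Function.ne_iff.1 hv0
    refine ⟨I.1, I.2, ?_⟩
    change (if h : I.1.card = k then (v ⟨I.1, h⟩ : Polynomial ℂ) else 0) ≠ 0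
    rw [dif_pos I.2]
    simpa using hI
  · intro J hJ h0 l hl
    change (hpForm F J (hpExt m k D v)).coeff l = 0
    by_cases hlD : l < -(D : ℤ)
    · exact hpForm_low F J _ D (hpExt_natDegree m k D v) l hlD
    · have hsum : D + k * n = (m + 1) * n := by
        rw [hD, ← add_mul]; congr 1; omega
      have hsum' : (D : ℤ) + k * n = ((m + 1) * n : ℕ) := by rw [← hsum]; push_cast; ring
      have hJm : J ∈ Finset.powersetCard k (Finset.univ.erase (0 : Fin (m + 1))) := by
        rw [Finset.mem_powersetCard]
        refine ⟨fun x hx => ?_, hJ⟩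
        simp only [Finset.mem_erase, Finset.mem_univ, and_true]
        rintro rfl
        exact h0 hx
      have hi : (l + D).toNat < (m + 1) * n + 1 := by omega
      have := congrFun (congrFun (LinearMap.mem_ker.1 hv) ⟨J, hJm⟩) ⟨(l + D).toNat, hi⟩
      change (hpForm F J (hpExt m k D v)).coeff (((l + D).toNat : ℤ) - D) = 0 at this
      rwa [show (((l + D).toNat : ℤ) - D) = l by omega] at this
end

section
/- The inhomogeneous conditions defining the k-th polynomials of the Hermite–Padé m-system imply all the homogeneous ones: let m ≥ 1, 1 ≤ k ≤ m, n ≥ 1, and F_0 = 1, F_1, …, F_m ∈ ℂ⟦t⟧. Suppose (P_I)_I is a family of polynomials indexed by the k-element subsets I of {0,1,…,m}, with deg P_I ≤ (m+1−k)·n, such that for every k-element subset J = {j_1 < ⋯ < j_k} of {1,…,m} the Laurent series ι(P_J) + Σ_{s=1}^{k} (−1)^s · ι(P_{(J∖{j_s})∪{0}}) · F_{j_s} is O(z^{−(kn+1)}) at ∞. Then for every (k+1)-element subset {i_0 < i_1 < ⋯ < i_k} of {0,1,…,m} the Laurent series Σ_{s=0}^{k} (−1)^s · ι(P_{{i_0,…,i_k}∖{i_s}})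 · F_{i_s} is O(z^{−(kn+1)}) at ∞. -/
lemma isBigO_mul_ps (G : LaurentSeries ℂ) (r : ℤ) (hG : IsBigOAtInfty G r) (F : PowerSeries ℂ) :
    IsBigOAtInfty (G * psToLaurent F) r := by
  intro l hl
  rw [HahnSeries.coeff_mul]
  apply Finset.sum_eq_zero
  rintro ⟨a, b⟩ hab
  rw [Finset.mem_addAntidiagonal] at hab
  obtain ⟨_, _, hs⟩ := hab
  simp only at hs ⊢
  by_cases ha : a < r
  · rw [hG a ha, zero_mul]
  · have hb : b < 0 := by omega
    have : (psToLaurent F).coeff b = 0 := by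
      unfold psToLaurent
      rw [PowerSeries.coeff_coe, if_pos hb]
    rw [this, mul_zero]

lemma isBigO_sign (G : LaurentSeries ℂ) (r : ℤ) (hG : IsBigOAtInfty G r) (a : ℕ) :
    IsBigOAtInfty ((-1) ^ a * G) r := by
  intro l hl
  rcases neg_one_pow_eq_or (LaurentSeries ℂ) a with h | h <;> simp [h, hG l hl]

lemma isBigO_sum {α : Type*} (s : Finset α) (G : α → LaurentSeries ℂ) (r : ℤ)
    (hG : ∀ i ∈ s, IsBigOAtInfty (G i) r) : IsBigOAtInfty (∑ i ∈ s, G i) r := by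
  intro l hl
  rw [HahnSeries.coeff_sum]
  exact Finset.sum_eq_zero fun i hi => hG i hi l hl

lemma polyToLaurent_one_ps : psToLaurent 1 = 1 := by
  simp [psToLaurent]

lemma card_le_of_lt {α : Type*} [LinearOrder α] (K : Finset α) {i j : α} (hj : j ∈ K)
    (h : j < i) :
    ((K.erase i).filter (· ≤ j)).card = (K.filter (· < j)).card + 1 := by
  have : (K.erase i).filter (· ≤ j) = insert j (K.filter (· < j)) := by
    ext x
    simp only [Finset.mem_filter, Finset.mem_erase, Finset.mem_insert]
    constructor
    · rintro ⟨⟨_, h2⟩, h3⟩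
      rcases h3.eq_or_lt with h4 | h4
      · exact Or.inl h4
      · exact Or.inr ⟨h2, h4⟩
    · rintro (rfl | ⟨h2, h3⟩)
      · exact ⟨⟨h.ne, hj⟩, le_rfl⟩
      · exact ⟨⟨(h3.trans h).ne, h2⟩, h3.le⟩
  rw [this, Finset.card_insert_of_notMem (by simp)]

lemma card_le_of_gt {α : Type*} [LinearOrder α] (K : Finset α) {i j : α} (hi : i ∈ K) (hj : j ∈ K)
    (h : i < j) :
    ((K.erase i).filter (· ≤ j)).card = (K.filter (· < j)).card := by
  have e : (K.erase i).filter (· ≤ j) = insert j ((K.filter (· < j)).erase i) := by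
    ext x
    simp only [Finset.mem_filter, Finset.mem_erase, Finset.mem_insert]
    constructor
    · rintro ⟨⟨h1, h2⟩, h3⟩
      rcases h3.eq_or_lt with h4 | h4
      · exact Or.inl h4
      · exact Or.inr ⟨h1, h2, h4⟩
    · rintro (rfl | ⟨h1, h2, h3⟩)
      · exact ⟨⟨h.ne', hj⟩, le_rfl⟩
      · exact ⟨⟨h1, h2⟩, h3.le⟩
  rw [e, Finset.card_insert_of_notMem (by simp)]
  exact Finset.card_erase_add_one (by simp [hi, h])

lemma sign_antisymm {α : Type*} [LinearOrder α] (K : Finset α) {i j : α} (hi : i ∈ K) (hj : j ∈ K)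
    (h : i ≠ j) :
    (-1 : LaurentSeries ℂ) ^ (K.filter (· < i)).card * (-1) ^ ((K.erase i).filter (· ≤ j)).card =
    -((-1) ^ (K.filter (· < j)).card * (-1) ^ ((K.erase j).filter (· ≤ i)).card) := by
  rcases lt_or_gt_of_ne h with h | h
  · rw [card_le_of_gt K hi hj h, card_le_of_lt K hi h]; ring
  · rw [card_le_of_gt K hj hi h, card_le_of_lt K hj h]; ring

lemma expand_term {R α : Type*} [CommRing R] (s : Finset α) (a p f : R) (b q g : α → R) :
    a * p * f + ∑ j ∈ s, a * b j * (q j * f * g j) = (a * (p + ∑ j ∈ s, b j * q j * g j)) * f := by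
  rw [mul_add, add_mul, Finset.mul_sum, Finset.sum_mul]
  congr 1
  refine Finset.sum_congr rfl fun j _ => ?_
  ring

lemma double_sum_zero {α : Type*} [DecidableEq α] (K : Finset α) (f : α → α → LaurentSeries ℂ)
    (hf : ∀ i ∈ K, ∀ j ∈ K, i ≠ j → f i j = - f j i) :
    ∑ i ∈ K, ∑ j ∈ K.erase i, f i j = 0 := by
  have h1 : ∑ i ∈ K, ∑ j ∈ K.erase i, f i j = ∑ j ∈ K, ∑ i ∈ K.erase j, f i j := by
    apply Finset.sum_comm'
    intro x y
    simp only [Finset.mem_erase]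
    tauto
  have h2 : ∑ j ∈ K, ∑ i ∈ K.erase j, f i j = - ∑ i ∈ K, ∑ j ∈ K.erase i, f i j := by
    rw [← Finset.sum_neg_distrib]
    refine Finset.sum_congr rfl fun i hi => ?_
    rw [← Finset.sum_neg_distrib]
    refine Finset.sum_congr rfl fun j hj => ?_
    rw [Finset.mem_erase] at hj
    exact hf j hj.2 i hi hj.1
  rw [h2] at h1
  ext l
  have h3 := congrArg (fun G => HahnSeries.coeff G l) h1
  simp only [HahnSeries.coeff_neg] at h3
  rw [HahnSeries.coeff_zero]
  linear_combination h3 / 2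

/-- The inhomogeneous conditions defining the `k`-th polynomials of the Hermite–Padé
`m`-system imply all the homogeneous ones: if for every `k`-element subset
`J = {j₁ < ⋯ < j_k}` of `{1, …, m}` the Laurent series
`ι(P_J) + ∑ₛ (−1)ˢ · ι(P_{(J∖{jₛ})∪{0}}) · F_{jₛ}` is `O(z^(−(kn+1)))` at `∞`,
then for every `(k+1)`-element subset `{i₀ < i₁ < ⋯ < i_k}` of `{0, 1, …, m}`
the Laurent series `∑ₛ (−1)ˢ · ι(P_{{i₀,…,i_k}∖{iₛ}}) · F_{iₛ}` is
`O(z^(−(kn+1)))` at `∞`.  (The sign `(−1)ˢ` is the parity of the 0-based rank of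
`iₛ` in the subset, i.e. the number of elements strictly below `iₛ`.) -/
theorem hermitePade_inhomogeneous_implies_homogeneous
    (m k n : ℕ) (hm : 1 ≤ m) (hk1 : 1 ≤ k) (hkm : k ≤ m) (hn : 1 ≤ n)
    (F : Fin (m + 1) → PowerSeries ℂ) (hF0 : F 0 = 1)
    (P : Finset (Fin (m + 1)) → Polynomial ℂ)
    (hdeg : ∀ I : Finset (Fin (m + 1)), I.card = k →
      (P I).natDegree ≤ (m + 1 - k) * n)
    (hOrd : ∀ J : Finset (Fin (m + 1)), J.card = k → (0 : Fin (m + 1)) ∉ J →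
      IsBigOAtInfty
        (polyToLaurent (P J) +
          ∑ j ∈ J, (-1 : LaurentSeries ℂ) ^ (J.filter (· ≤ j)).card *
            polyToLaurent (P (insert 0 (J.erase j))) * psToLaurent (F j))
        (k * n + 1)) :
    ∀ K : Finset (Fin (m + 1)), K.card = k + 1 →
      IsBigOAtInfty
        (∑ i ∈ K, (-1 : LaurentSeries ℂ) ^ (K.filter (· < i)).card *
          polyToLaurent (P (K.erase i)) * psToLaurent (F i))
        (k * n + 1) := by
  intro K hK
  by_cases h0 : (0 : Fin (m + 1)) ∈ K
  · have h := hOrd (K.erase 0) (by rw [Finset.card_erase_of_mem h0, hK]; rfl) (by simp)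
    convert h using 1
    rw [← Finset.add_sum_erase K _ h0]
    congr 1
    · simp [hF0, polyToLaurent_one_ps]
    · refine Finset.sum_congr rfl fun j hj => ?_
      rw [Finset.mem_erase] at hj
      have hpos : (0 : Fin (m + 1)) < j := Fin.pos_iff_ne_zero.mpr hj.1
      rw [card_le_of_gt K h0 hj.2 hpos, Finset.erase_right_comm, Finset.insert_erase]
      exact Finset.mem_erase.mpr ⟨hj.1.symm, h0⟩
  · have hz := double_sum_zero K (fun i j => (-1 : LaurentSeries ℂ) ^ (K.filter (· < i)).card *
        (-1) ^ ((K.erase i).filter (· ≤ j)).card *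
        (polyToLaurent (P (insert 0 ((K.erase i).erase j))) * psToLaurent (F i)
          * psToLaurent (F j))) (by
      intro i hi j hj hij
      rw [sign_antisymm K hi hj hij, Finset.erase_right_comm]
      ring)
    have key : ∑ i ∈ K, (-1 : LaurentSeries ℂ) ^ (K.filter (· < i)).card *
          polyToLaurent (P (K.erase i)) * psToLaurent (F i) =
        ∑ i ∈ K, ((-1 : LaurentSeries ℂ) ^ (K.filter (· < i)).card *
          (polyToLaurent (P (K.erase i)) +
          ∑ j ∈ K.erase i, (-1 : LaurentSeries ℂ) ^ ((K.erase i).filter (· ≤ j)).card *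
            polyToLaurent (P (insert 0 ((K.erase i).erase j))) * psToLaurent (F j))) *
            psToLaurent (F i) := by
      rw [← add_zero (∑ i ∈ K, _), ← hz, ← Finset.sum_add_distrib]
      refine Finset.sum_congr rfl fun i hi => ?_
      exact expand_term _ _ _ _ _ _ _
    rw [key]
    refine isBigO_sum _ _ _ fun i hi => isBigO_mul_ps _ _ (isBigO_sign _ _ ?_ _) _
    exact hOrd (K.erase i) (by rw [Finset.card_erase_of_mem hi, hK]; rfl)
      (fun h => h0 (Finset.mem_of_mem_erase h))
end

section
/- Hermite–Padé polynomials of type I, with the sign of the odd-indexed polynomials reversed, are m-th polynomials of the Hermite–Padé m-system: let m ≥ 1, n ≥ 1, and F_0 = 1, F_1, …, F_m ∈ ℂ⟦t⟧. Suppose Q_0, …, Q_m ∈ ℂ[z] satisfy deg Q_j ≤ n for all j, not all Q_j are zero, and the Laurent series Σ_{j=0}^{m} ι(Q_j)·F_j is O(z^{−m(n+1)}) at ∞. For each j ∈ {0,…,m} define P_{{0,…,m}∖{j}} := (−1)^j · Q_j. Then the family (P_I)_I, indexed by the m-element subsets I of {0,…,m}, satisfies deg P_I ≤ (m+1−m)·n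 = n, not all P_I are zero, and for the unique m-element subset J = {1,…,m} of {1,…,m} the Laurent series ι(P_J) + Σ_{s=1}^{m} (−1)^s · ι(P_{(J∖{s})∪{0}}) · F_s is O(z^{−(mn+1)}) at ∞. -/
theorem polyToLaurent_neg_aux (p : Polynomial ℂ) : polyToLaurent (-p) = -polyToLaurent p := by
  simp [polyToLaurent, Finset.sum_neg_distrib]

theorem laurent_neg_one_mul_aux : (-1 : LaurentSeries ℂ) * -1 = 1 := by ring

theorem polyToLaurent_sign_aux (k : ℕ) (p : Polynomial ℂ) :
    polyToLaurent ((-1 : Polynomial ℂ) ^ k * p) = (-1 : LaurentSeries ℂ) ^ k * polyToLaurent p := by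
  rcases Nat.even_or_odd k with h | h
  · have h1 : (-1 : LaurentSeries ℂ) ^ k = 1 := by
      obtain ⟨r, rfl⟩ := h
      rw [pow_add, ← mul_pow, laurent_neg_one_mul_aux, one_pow]
    rw [h1, h.neg_one_pow, one_mul, one_mul]
  · have h1 : (-1 : LaurentSeries ℂ) ^ k = -1 := by
      obtain ⟨r, rfl⟩ := h
      rw [pow_succ, two_mul, pow_add, ← mul_pow, laurent_neg_one_mul_aux, one_pow, one_mul]
    rw [h1, h.neg_one_pow, neg_one_mul, polyToLaurent_neg_aux]
    ring

theorem natDegree_sign_aux (k : ℕ) (p : Polynomial ℂ) :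
    ((-1 : Polynomial ℂ) ^ k * p).natDegree = p.natDegree := by
  rcases Nat.even_or_odd k with h | h <;> simp [h.neg_one_pow]

theorem card_filter_aux {m : ℕ} (j : Fin (m + 1)) :
    ((Finset.univ.erase (0 : Fin (m + 1))).filter (· ≤ j)).card = (j : ℕ) := by
  have : (Finset.univ.erase (0 : Fin (m + 1))).filter (· ≤ j) = Finset.Ioc 0 j := by
    ext x
    simp [Fin.pos_iff_ne_zero]
  rw [this, Fin.card_Ioc]
  simp

/-- Hermite–Padé polynomials of type I, with the sign of the odd-indexed polynomials
reversed, are `m`-th polynomials of the Hermite–Padé `m`-system: if `Q₀, …, Q_m` have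
degrees at most `n`, are not all zero, and `∑ⱼ ι(Qⱼ)·Fⱼ = O(z^(−m(n+1)))` at `∞`,
then the family `P_{{0,…,m}∖{j}} := (−1)ʲ·Qⱼ`, indexed by the `m`-element subsets of
`{0, …, m}`, has degrees at most `(m+1−m)·n = n`, is not all zero, and for the unique
`m`-element subset `J = {1, …, m}` of `{1, …, m}` the Laurent series
`ι(P_J) + ∑ₛ (−1)ˢ · ι(P_{(J∖{s})∪{0}}) · Fₛ` is `O(z^(−(mn+1)))` at `∞`. -/
theorem hermitePade_typeI_are_mth_polynomials
    (m n : ℕ) (hm : 1 ≤ m) (hn : 1 ≤ n)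
    (F : Fin (m + 1) → PowerSeries ℂ) (hF0 : F 0 = 1)
    (Q : Fin (m + 1) → Polynomial ℂ)
    (hQdeg : ∀ j, (Q j).natDegree ≤ n)
    (hQne : ∃ j, Q j ≠ 0)
    (hQOrd : IsBigOAtInfty
      (∑ j : Fin (m + 1), polyToLaurent (Q j) * psToLaurent (F j))
      (m * (n + 1)))
    (P : Finset (Fin (m + 1)) → Polynomial ℂ)
    (hP : ∀ j : Fin (m + 1),
      P (Finset.univ.erase j) = (-1 : Polynomial ℂ) ^ (j : ℕ) * Q j) :
    (∀ I : Finset (Fin (m + 1)), I.card = m → (P I).natDegree ≤ (m + 1 - m) * n) ∧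
    (∃ I : Finset (Fin (m + 1)), I.card = m ∧ P I ≠ 0) ∧
    IsBigOAtInfty
      (polyToLaurent (P (Finset.univ.erase (0 : Fin (m + 1)))) +
        ∑ j ∈ Finset.univ.erase (0 : Fin (m + 1)),
          (-1 : LaurentSeries ℂ) ^
              (((Finset.univ.erase (0 : Fin (m + 1))).filter (· ≤ j)).card) *
            polyToLaurent
              (P (insert 0 ((Finset.univ.erase (0 : Fin (m + 1))).erase j))) *
            psToLaurent (F j))
      (m * n + 1) := by
  refine ⟨?_, ?_, ?_⟩
  · intro I hI
    have hc : Iᶜ.card = 1 := by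
      rw [Finset.card_compl, hI, Fintype.card_fin]
      omega
    obtain ⟨j, hj⟩ := Finset.card_eq_one.mp hc
    have hIj : I = Finset.univ.erase j := by
      rw [← compl_compl I, hj]
      ext x
      simp
    rw [hIj, hP, natDegree_sign_aux]
    have : m + 1 - m = 1 := by omega
    rw [this, one_mul]
    exact hQdeg j
  · obtain ⟨j, hj⟩ := hQne
    refine ⟨Finset.univ.erase j, by simp, ?_⟩
    rw [hP]
    exact mul_ne_zero (pow_ne_zero _ (by simp)) hj
  · have key : (polyToLaurent (P (Finset.univ.erase (0 : Fin (m + 1)))) +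
        ∑ j ∈ Finset.univ.erase (0 : Fin (m + 1)),
          (-1 : LaurentSeries ℂ) ^
              (((Finset.univ.erase (0 : Fin (m + 1))).filter (· ≤ j)).card) *
            polyToLaurent
              (P (insert 0 ((Finset.univ.erase (0 : Fin (m + 1))).erase j))) *
            psToLaurent (F j)) =
        ∑ j : Fin (m + 1), polyToLaurent (Q j) * psToLaurent (F j) := by
      rw [← Finset.add_sum_erase Finset.univ _ (Finset.mem_univ (0 : Fin (m + 1)))]
      congr 1
      · rw [hP, hF0]
        simp [psToLaurent]
      · refine Finset.sum_congr rfl fun j hj => ?_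
        have hj0 : j ≠ 0 := Finset.ne_of_mem_erase hj
        have hset : insert 0 ((Finset.univ.erase (0 : Fin (m + 1))).erase j) =
            Finset.univ.erase j := by
          ext x
          by_cases hx : x = 0
          · simp [hx, hj0.symm]
          · simp [hx]
        rw [hset, hP, card_filter_aux, polyToLaurent_sign_aux, ← mul_assoc, ← mul_pow]
        have h1 : (-1 : LaurentSeries ℂ) * -1 = 1 := by ring
        rw [h1, one_pow, one_mul]
    rw [key]
    intro l hl
    refine hQOrd l (lt_of_lt_of_le hl ?_)
    have : (1 : ℤ) ≤ m := by exact_mod_cast hm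
    rw [mul_add, mul_one]
    linarith
end

section
/- Let α be a finite type, let S be a set of transpositions in Perm(α), and let G be the subgroup of Perm(α) generated by S. Assume G acts transitively on α, i.e., for all a, b ∈ α there is g ∈ G with g(a) = b. Then for every k ≥ 1 and every injective tuple of elements i_1, …, i_{k+1} ∈ α there exists g ∈ G such that g(i_s) = i_s for all 1 ≤ s ≤ k−1 and g(i_k) = i_{k+1}. -/
/-- If a subgroup `G` of the permutation group of a finite type `α` is generated by a
set `S` of transpositions and acts transitively on `α`, then for every `k ≥ 1` and
every injective tuple `i₁, …, i_{k+1}` of elements of `α` (here 0-indexed as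
`i 0, …, i k`) there is `g ∈ G` fixing `i₁, …, i_{k−1}` and sending `i_k` to
`i_{k+1}`. -/
theorem exists_perm_fixing_and_moving (α : Type*) [Finite α] [DecidableEq α]
    (S : Set (Equiv.Perm α))
    (hS : ∀ σ ∈ S, ∃ a b : α, a ≠ b ∧ σ = Equiv.swap a b)
    (htrans : ∀ a b : α, ∃ g ∈ Subgroup.closure S, g a = b)
    (k : ℕ) (hk : 1 ≤ k) (i : Fin (k + 1) → α) (hi : Function.Injective i) :
    ∃ g ∈ Subgroup.closure S,
      (∀ s : Fin (k + 1), (s : ℕ) < k - 1 → g (i s) = i s) ∧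
      g (i ⟨k - 1, by omega⟩) = i ⟨k, by omega⟩ := by
  have hS' : ∀ σ ∈ S, σ.IsSwap := fun σ hσ => hS σ hσ
  have hg : Equiv.swap (i ⟨k - 1, by omega⟩) (i ⟨k, by omega⟩) ∈ Subgroup.closure S := by
    rw [swap_mem_closure_isSwap hS']
    obtain ⟨g, hg, h⟩ := htrans (i ⟨k, by omega⟩) (i ⟨k - 1, by omega⟩)
    exact ⟨⟨g, hg⟩, h⟩
  refine ⟨_, hg, ?_, Equiv.swap_apply_left _ _⟩
  intro s hs
  apply Equiv.swap_apply_of_ne_of_ne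
  · intro h
    have := congrArg Fin.val (hi h)
    simp only at this
    omega
  · intro h
    have := congrArg Fin.val (hi h)
    simp only at this
    omega
end

section
/- Let α be a finite type, let S be a set of transpositions in Perm(α), and let G be the subgroup of Perm(α) generated by S. Assume G acts transitively on α, i.e., for all a, b ∈ α there is g ∈ G with g(a) = b. Then for every k ≥ 1, G acts transitively on the k-element subsets of α: for any two finite subsets A, B ⊆ α with |A| = |B| = k there exists g ∈ G whose image of A equals B. -/
/-- If a subgroup `G` of the permutation group of a finite type `α` is generated by a
set `S` of transpositions and acts transitively on `α`, then for every `k ≥ 1` it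
acts transitively on the `k`-element subsets of `α`: for any finite subsets
`A, B ⊆ α` with `|A| = |B| = k` there is `g ∈ G` with `g(A) = B`. -/
theorem transitive_on_k_subsets (α : Type*) [Finite α] [DecidableEq α]
    (S : Set (Equiv.Perm α))
    (hS : ∀ σ ∈ S, ∃ a b : α, a ≠ b ∧ σ = Equiv.swap a b)
    (htrans : ∀ a b : α, ∃ g ∈ Subgroup.closure S, g a = b)
    (k : ℕ) (hk : 1 ≤ k) (A B : Finset α) (hA : A.card = k) (hB : B.card = k) :
    ∃ g ∈ Subgroup.closure S, A.image (⇑g) = B := by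
  have hpre : MulAction.IsPretransitive (Subgroup.closure S) α :=
    ⟨fun a b => by
      obtain ⟨g, hg, h⟩ := htrans a b
      exact ⟨⟨g, hg⟩, h⟩⟩
  have htop : Subgroup.closure S = ⊤ := closure_of_isSwap_of_isPretransitive hS
  rw [htop]
  have e : {x // x ∈ A} ≃ {x // x ∈ B} := Finset.equivOfCardEq (hA.trans hB.symm)
  refine ⟨e.extendSubtype, Subgroup.mem_top _, ?_⟩
  apply Finset.eq_of_subset_of_card_le
  · intro y hy
    obtain ⟨x, hx, rfl⟩ := Finset.mem_image.mp hy
    exact e.extendSubtype_mem x hx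
  · rw [Finset.card_image_of_injective _ (Equiv.injective _), hA, hB]
end

section
/- Let m ≥ 3 and let k be an integer with 2 ≤ k and 2k ≤ m+1. In ℤ/(m+1), let A be the image of {0, 1, …, k−1} and let B be the image of {0, 1, …, k−2} ∪ {⌊(m+1)/2⌋}. Then A and B each have exactly k elements, and for every t ∈ ℤ/(m+1) the translate A + t := {a + t : a ∈ A} is different from B. -/
/-- The explicit pair of translation-inequivalent `k`-element subsets of `ℤ/(m+1)`
from the proof of Proposition 6.1: for `m ≥ 3` and `2 ≤ k` with `2k ≤ m + 1`, let
`A` be the image in `ℤ/(m+1)` of `{0, 1, …, k−1}` and let `B` be the image of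
`{0, 1, …, k−2} ∪ {⌊(m+1)/2⌋}`.  Then `A` and `B` each have exactly `k` elements
and no translate `A + t` equals `B`. -/
theorem zmod_explicit_nonequivalent_subsets
    (m k : ℕ) (hm : 3 ≤ m) (hk : 2 ≤ k) (hkm : 2 * k ≤ m + 1) :
    ((Finset.range k).image (fun i : ℕ => (i : ZMod (m + 1)))).card = k ∧
    (((Finset.range (k - 1)).image (fun i : ℕ => (i : ZMod (m + 1)))) ∪
        {(((m + 1) / 2 : ℕ) : ZMod (m + 1))}).card = k ∧
    ∀ t : ZMod (m + 1),
      ((Finset.range k).image (fun i : ℕ => (i : ZMod (m + 1)))).image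
          (fun a => a + t) ≠
        (((Finset.range (k - 1)).image (fun i : ℕ => (i : ZMod (m + 1)))) ∪
          {(((m + 1) / 2 : ℕ) : ZMod (m + 1))}) := by
  have inj : ∀ x y : ℕ, x < m + 1 → y < m + 1 →
      ((x : ZMod (m + 1)) = (y : ZMod (m + 1))) → x = y := by
    intro x y hx hy h
    have h' := (ZMod.natCast_eq_natCast_iff' x y (m + 1)).1 h
    rwa [Nat.mod_eq_of_lt hx, Nat.mod_eq_of_lt hy] at h'
  have cardI : ∀ j : ℕ, j ≤ m + 1 →
      ((Finset.range j).image (fun i : ℕ => (i : ZMod (m + 1)))).card = j := by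
    intro j hj
    rw [Finset.card_image_of_injOn, Finset.card_range]
    intro x hx y hy hxy
    simp only [Finset.coe_range, Set.mem_Iio] at hx hy
    exact inj x y (by omega) (by omega) hxy
  have memB : ∀ x : ℕ, x < m + 1 →
      (x : ZMod (m + 1)) ∈ (((Finset.range (k - 1)).image (fun i : ℕ => (i : ZMod (m + 1)))) ∪
        {(((m + 1) / 2 : ℕ) : ZMod (m + 1))}) → x < k - 1 ∨ x = (m + 1) / 2 := by
    intro x hx h
    rw [Finset.mem_union, Finset.mem_image, Finset.mem_singleton] at h
    rcases h with ⟨i, hi, hix⟩ | h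
    · rw [Finset.mem_range] at hi
      have := inj i x (by omega) hx hix
      omega
    · exact Or.inr (inj _ _ hx (by omega) h)
  refine ⟨cardI k (by omega), ?_, ?_⟩
  · rw [Finset.card_union_of_disjoint, cardI _ (by omega), Finset.card_singleton]
    · omega
    · rw [Finset.disjoint_singleton_right, Finset.mem_image]
      rintro ⟨i, hi, hix⟩
      rw [Finset.mem_range] at hi
      have := inj i _ (by omega) (by omega) hix
      omega
  · intro t heq
    have hmem : (((m + 1) / 2 : ℕ) : ZMod (m + 1)) ∈
        ((Finset.range k).image (fun i : ℕ => (i : ZMod (m + 1)))).image (fun a => a + t) := by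
      rw [heq]
      exact Finset.mem_union_right _ (Finset.mem_singleton_self _)
    have key : ∀ j : ℕ, j < k → (j : ZMod (m + 1)) + t ∈
        (((Finset.range (k - 1)).image (fun i : ℕ => (i : ZMod (m + 1)))) ∪
          {(((m + 1) / 2 : ℕ) : ZMod (m + 1))}) := by
      intro j hj
      rw [← heq]
      exact Finset.mem_image_of_mem _ (Finset.mem_image_of_mem _ (Finset.mem_range.2 hj))
    rw [Finset.mem_image] at hmem
    obtain ⟨a, ha, hat⟩ := hmem
    rw [Finset.mem_image] at ha
    obtain ⟨i, hi, rfl⟩ := ha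
    rw [Finset.mem_range] at hi
    obtain ⟨h, hh⟩ : ∃ h, (m + 1) / 2 = h + 1 := ⟨(m + 1) / 2 - 1, by omega⟩
    rcases i with _ | i
    · have h1 := key 1 (by omega)
      have e : ((1 : ℕ) : ZMod (m + 1)) + t = (((m + 1) / 2 + 1 : ℕ) : ZMod (m + 1)) := by
        rw [Nat.cast_add, ← hat]
        push_cast
        ring
      rw [e] at h1
      have := memB _ (by omega) h1
      omega
    · have h1 := key i (by omega)
      have e : (i : ZMod (m + 1)) + t = (h : ZMod (m + 1)) := by
        rw [hh] at hat
        push_cast at hat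
        linear_combination hat
      rw [e] at h1
      have := memB _ (by omega) h1
      omega
end
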